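/- Let a > 0, let V : ℝ → ℝ be real-analytic, and let λ < μ be real numbers. Suppose f and g are Dirichlet eigenfunctions of L = −d²/dx² − V on [0,a] for the eigenvalues λ and μ respectively. If f has exactly m zeros in [0,a], then g has at least m + 1 zeros in [0,a]. -/

import Mathlib

/-- `f` is a Dirichlet eigenfunction on `[0,a]` of `L = -d²/dx² - V` with eigenvalue `lam`. -/
def IsDirichletEigenfunction (a : ℝ) (V : ℝ → ℝ) (lam : ℝ) (f : ℝ → ℝ) : Prop :=
  ContDiff ℝ (⊤ : ℕ∞) f ∧ f ≠ 0 ∧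
    (∀ x : ℝ, deriv (deriv f) x + (V x + lam) * f x = 0) ∧ f 0 = 0 ∧ f a = 0

open Set Filter Topology

/-- A solution of `u'' = -q u` with continuous `q` and vanishing Cauchy data at a point is zero. -/
lemma eq_zero_of_cauchy_data_eq_zero {q u u' : ℝ → ℝ} (hq : Continuous q)
    (hu : ∀ x, HasDerivAt u (u' x) x) (hu' : ∀ x, HasDerivAt u' (-(q x * u x)) x)
    {x₀ : ℝ} (h0 : u x₀ = 0) (h0' : u' x₀ = 0) : u = 0 := by
  funext x
  obtain ⟨M, hM⟩ := isCompact_uIcc.exists_bound_of_continuousOn (s := uIcc x₀ x) hq.continuousOn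
  have hM0 : 0 ≤ M := (norm_nonneg _).trans (hM x₀ left_mem_uIcc)
  have hE : ∀ (K t : ℝ), HasDerivAt (fun s => (u s ^ 2 + u' s ^ 2) * Real.exp (K * s))
      ((2 * (u t * u' t) * (1 - q t) + K * (u t ^ 2 + u' t ^ 2)) * Real.exp (K * t)) t := by
    intro K t
    have h := (((hu t).pow 2).add ((hu' t).pow 2)).mul (((hasDerivAt_id t).const_mul K).exp)
    refine h.congr_deriv ?_
    simp
    ring
  have hbound : ∀ t ∈ uIcc x₀ x,
      |2 * (u t * u' t) * (1 - q t)| ≤ (1 + M) * (u t ^ 2 + u' t ^ 2) := by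
    intro t ht
    have h1 : |1 - q t| ≤ 1 + M := by
      have := abs_le.1 (hM t ht)
      exact abs_le.2 ⟨by linarith, by linarith⟩
    have h2 : |2 * (u t * u' t)| ≤ u t ^ 2 + u' t ^ 2 :=
      abs_le.2 ⟨by nlinarith [sq_nonneg (u t + u' t)], by nlinarith [sq_nonneg (u t - u' t)]⟩
    rw [abs_mul, mul_comm]
    exact mul_le_mul h1 h2 (abs_nonneg _) (by linarith)
  have key : ∃ K : ℝ, (u x ^ 2 + u' x ^ 2) * Real.exp (K * x) ≤ 0 := by
    rcases le_total x₀ x with hx | hx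
    · refine ⟨-(1 + M), ?_⟩
      have hanti := antitoneOn_of_deriv_nonpos (convex_Icc x₀ x)
        (fun t _ => (hE (-(1 + M)) t).continuousAt.continuousWithinAt)
        (fun t _ => (hE (-(1 + M)) t).differentiableAt.differentiableWithinAt)
        (fun t ht => by
          rw [(hE _ t).deriv]
          have := (abs_le.1 (hbound t (by rw [uIcc_of_le hx]; exact interior_subset ht))).2
          exact mul_nonpos_of_nonpos_of_nonneg (by linarith) (Real.exp_pos _).le)
      simpa [h0, h0'] using hanti (left_mem_Icc.2 hx) (right_mem_Icc.2 hx) hx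
    · refine ⟨1 + M, ?_⟩
      have hmono := monotoneOn_of_deriv_nonneg (convex_Icc x x₀)
        (fun t _ => (hE (1 + M) t).continuousAt.continuousWithinAt)
        (fun t _ => (hE (1 + M) t).differentiableAt.differentiableWithinAt)
        (fun t ht => by
          rw [(hE _ t).deriv]
          have := (abs_le.1 (hbound t (by rw [uIcc_of_ge hx]; exact interior_subset ht))).1
          exact mul_nonneg (by linarith) (Real.exp_pos _).le)
      simpa [h0, h0'] using hmono (left_mem_Icc.2 hx) (right_mem_Icc.2 hx) hx
  obtain ⟨K, hK⟩ := key
  have h1 : u x ^ 2 + u' x ^ 2 ≤ 0 := nonpos_of_mul_nonpos_left hK (Real.exp_pos _)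
  have h2 : u x ^ 2 = 0 := le_antisymm (by nlinarith [sq_nonneg (u' x)]) (sq_nonneg _)
  simpa using h2

/-- A nonzero solution of `u'' = -q u` has finitely many zeros in a compact interval. -/
lemma finite_zeros_Icc {q u u' : ℝ → ℝ} (hq : Continuous q)
    (hu : ∀ x, HasDerivAt u (u' x) x) (hu' : ∀ x, HasDerivAt u' (-(q x * u x)) x)
    (hne : u ≠ 0) (a b : ℝ) : {x : ℝ | x ∈ Icc a b ∧ u x = 0}.Finite := by
  by_contra hinf
  obtain ⟨x, -, hx⟩ := Set.Infinite.exists_accPt_of_subset_isCompact hinf isCompact_Icc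
    (fun x hx => hx.1)
  have hfreq : ∃ᶠ y in 𝓝[≠] x, u y = 0 :=
    (accPt_iff_frequently_nhdsNE.1 hx).mono fun y hy => hy.2
  have hclosed : IsClosed {y | u y = 0} :=
    isClosed_eq (continuous_iff_continuousAt.2 fun y => (hu y).continuousAt) continuous_const
  have hx0 : u x = 0 :=
    hclosed.mem_of_frequently_of_tendsto hfreq (tendsto_id.mono_left nhdsWithin_le_nhds)
  refine hne (eq_zero_of_cauchy_data_eq_zero hq hu hu' hx0 ?_)
  by_contra hder
  exact hfreq ((hu x).eventually_ne hder)

/-- A continuous function without zeros on an open interval has constant sign there. -/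
lemma pos_or_neg_of_ne_zero_Ioo {u : ℝ → ℝ} (hu : Continuous u) {x y : ℝ}
    (h : ∀ t ∈ Ioo x y, u t ≠ 0) : (∀ t ∈ Ioo x y, 0 < u t) ∨ ∀ t ∈ Ioo x y, 0 < -u t := by
  by_contra! hcon
  obtain ⟨⟨s, hs, hs'⟩, t, ht, ht'⟩ := hcon
  obtain ⟨c, hc, hc'⟩ := isPreconnected_Ioo.intermediate_value hs ht hu.continuousOn
    (show (0 : ℝ) ∈ Icc (u s) (u t) from ⟨hs', by linarith⟩)
  exact h c hc hc'

/-- Sturm comparison for positive solutions: between two zeros of `f` on which `f` is positive,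
`g` cannot remain positive. -/
lemma sturm_comparison_pos {p q f f' g g' : ℝ → ℝ} {x y : ℝ} (hxy : x < y)
    (hpq : ∀ t ∈ Ioo x y, p t < q t)
    (hf : ∀ t, HasDerivAt f (f' t) t) (hf' : ∀ t, HasDerivAt f' (-(p t * f t)) t)
    (hg : ∀ t, HasDerivAt g (g' t) t) (hg' : ∀ t, HasDerivAt g' (-(q t * g t)) t)
    (hx : f x = 0) (hy : f y = 0) (hfpos : ∀ t ∈ Ioo x y, 0 < f t)
    (hgpos : ∀ t ∈ Ioo x y, 0 < g t) : False := by
  have hW : ∀ t, HasDerivAt (fun s => f s * g' s - f' s * g s) ((p t - q t) * (f t * g t)) t := by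
    intro t
    refine (((hf t).mul (hg' t)).sub ((hf' t).mul (hg t))).congr_deriv ?_
    ring
  have hanti := strictAntiOn_of_deriv_neg (convex_Icc x y)
    (fun t _ => (hW t).continuousAt.continuousWithinAt)
    (fun t ht => by
      rw [interior_Icc] at ht
      rw [(hW t).deriv]
      exact mul_neg_of_neg_of_pos (sub_neg.2 (hpq t ht)) (mul_pos (hfpos t ht) (hgpos t ht)))
  have hlt := hanti (left_mem_Icc.2 hxy.le) (right_mem_Icc.2 hxy.le) hxy
  have hgnn : ∀ t ∈ Icc x y, 0 ≤ g t := by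
    have hcl : IsClosed {t | 0 ≤ g t} := isClosed_le continuous_const
      (continuous_iff_continuousAt.2 fun t => (hg t).continuousAt)
    rw [← closure_Ioo hxy.ne]
    exact closure_minimal (fun t ht => (hgpos t ht).le) hcl
  have hfx : 0 ≤ f' x := by
    refine ge_of_tendsto ((hasDerivAt_iff_tendsto_slope.1 (hf x)).mono_left
      (nhdsWithin_mono x fun t (ht : t ∈ Ioi x) => ne_of_gt ht)) ?_
    filter_upwards [Ioo_mem_nhdsGT hxy] with t ht
    rw [slope_def_field, hx]
    exact div_nonneg (by linarith [hfpos t ht]) (by linarith [ht.1])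
  have hfy : f' y ≤ 0 := by
    refine le_of_tendsto ((hasDerivAt_iff_tendsto_slope.1 (hf y)).mono_left
      (nhdsWithin_mono y fun t (ht : t ∈ Iio y) => ne_of_lt ht)) ?_
    filter_upwards [Ioo_mem_nhdsLT hxy] with t ht
    rw [slope_def_field, hy]
    exact div_nonpos_of_nonneg_of_nonpos (by linarith [hfpos t ht]) (by linarith [ht.2])
  simp only [hx, hy, zero_mul, zero_sub] at hlt
  have h1 := mul_nonneg hfx (hgnn x (left_mem_Icc.2 hxy.le))
  have h2 := mul_nonpos_of_nonpos_of_nonneg hfy (hgnn y (right_mem_Icc.2 hxy.le))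
  linarith

/-- Sturm comparison: `g` has a zero strictly between two consecutive zeros of `f`. -/
lemma sturm_comparison {p q f f' g g' : ℝ → ℝ} {x y : ℝ} (hxy : x < y)
    (hpq : ∀ t ∈ Ioo x y, p t < q t)
    (hf : ∀ t, HasDerivAt f (f' t) t) (hf' : ∀ t, HasDerivAt f' (-(p t * f t)) t)
    (hg : ∀ t, HasDerivAt g (g' t) t) (hg' : ∀ t, HasDerivAt g' (-(q t * g t)) t)
    (hx : f x = 0) (hy : f y = 0) (hfne : ∀ t ∈ Ioo x y, f t ≠ 0) :
    ∃ c ∈ Ioo x y, g c = 0 := by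
  by_contra! hgne
  have neg_deriv : ∀ {r u u' : ℝ → ℝ}, (∀ t, HasDerivAt u' (-(r t * u t)) t) →
      ∀ t, HasDerivAt (fun s => -u' s) (-(r t * -u t)) t :=
    fun h t => (h t).neg.congr_deriv (by ring)
  have hfn : ∀ t, HasDerivAt (fun s => -f s) (-f' t) t := fun t => (hf t).neg
  have hgn : ∀ t, HasDerivAt (fun s => -g s) (-g' t) t := fun t => (hg t).neg
  have hx' : -f x = 0 := by simp [hx]
  have hy' : -f y = 0 := by simp [hy]
  rcases pos_or_neg_of_ne_zero_Ioo (continuous_iff_continuousAt.2 fun t => (hf t).continuousAt)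
    hfne with hfs | hfs <;>
  rcases pos_or_neg_of_ne_zero_Ioo (continuous_iff_continuousAt.2 fun t => (hg t).continuousAt)
    hgne with hgs | hgs
  · exact sturm_comparison_pos hxy hpq hf hf' hg hg' hx hy hfs hgs
  · exact sturm_comparison_pos hxy hpq hf hf' hgn (neg_deriv hg') hx hy hfs hgs
  · exact sturm_comparison_pos hxy hpq hfn (neg_deriv hf') hg hg' hx' hy' hfs hgs
  · exact sturm_comparison_pos hxy hpq hfn (neg_deriv hf') hgn (neg_deriv hg') hx' hy' hfs hgs

/-- The first-order system satisfied by a Dirichlet eigenfunction and its derivative. -/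
lemma IsDirichletEigenfunction.hasDerivAt {a : ℝ} {V : ℝ → ℝ} {lam : ℝ} {f : ℝ → ℝ}
    (hf : IsDirichletEigenfunction a V lam f) :
    (∀ x, HasDerivAt f (deriv f x) x) ∧
      ∀ x, HasDerivAt (deriv f) (-((V x + lam) * f x)) x := by
  obtain ⟨hs, -, heq, -, -⟩ := hf
  have hs' : ContDiff ℝ 2 f := mod_cast contDiff_infty.1 hs 2
  refine ⟨fun x => (hs'.differentiable (by norm_num) x).hasDerivAt, fun x => ?_⟩
  have hd : Differentiable ℝ (deriv f) := by
    have h2 : ContDiff ℝ (1 + 1) f := by simpa [one_add_one_eq_two] using hs'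
    exact ((contDiff_succ_iff_deriv.1 h2).2.2).differentiable (by norm_num)
  exact (hd x).hasDerivAt.congr_deriv (by linarith [heq x])

/-- If `f`, `g` are Dirichlet eigenfunctions for eigenvalues `lam < μ` and `f` has exactly
`m` zeros in `[0,a]`, then `g` has at least `m + 1` zeros in `[0,a]`. -/
theorem dirichlet_zeros_increase (a : ℝ) (ha : 0 < a) (V : ℝ → ℝ)
    (hV : AnalyticOnNhd ℝ V Set.univ) (lam μ : ℝ) (hlt : lam < μ) (f g : ℝ → ℝ)
    (hf : IsDirichletEigenfunction a V lam f) (hg : IsDirichletEigenfunction a V μ g)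
    (m : ℕ) (hm : {x : ℝ | x ∈ Set.Icc 0 a ∧ f x = 0}.ncard = m) :
    m + 1 ≤ {x : ℝ | x ∈ Set.Icc 0 a ∧ g x = 0}.ncard := by
  obtain ⟨hf1, hf2⟩ := hf.hasDerivAt
  obtain ⟨hg1, hg2⟩ := hg.hasDerivAt
  obtain ⟨-, hfne, -, hf0, hfa⟩ := hf
  obtain ⟨-, hgne, -, hg0, hga⟩ := hg
  have hVc : Continuous V := continuousOn_univ.1 hV.continuousOn
  have hS := finite_zeros_Icc (hVc.add continuous_const) hf1 hf2 hfne 0 a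
  have hT := finite_zeros_Icc (hVc.add continuous_const) hg1 hg2 hgne 0 a
  set S := {x : ℝ | x ∈ Icc 0 a ∧ f x = 0} with hSdef
  set T := {x : ℝ | x ∈ Icc 0 a ∧ g x = 0} with hTdef
  have haS : a ∈ S := ⟨⟨ha.le, le_rfl⟩, hfa⟩
  have hnext : ∀ x ∈ S \ {a}, ∃ c, g c = 0 ∧ x < c ∧ c < a ∧ ∀ z ∈ S, x < z → c < z := by
    rintro x ⟨⟨⟨hx0, hxa⟩, hfx⟩, hxne⟩
    obtain ⟨y, ⟨hyS, hxy⟩, hymin⟩ := Set.exists_min_image (S ∩ Ioi x) id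
      (hS.subset inter_subset_left) ⟨a, haS, lt_of_le_of_ne hxa hxne⟩
    obtain ⟨c, hc, hgc⟩ := sturm_comparison (y := y) hxy (fun t _ => by linarith) hf1 hf2 hg1 hg2
      hfx hyS.2 (fun t ht hft => absurd
        (hymin t ⟨⟨⟨hx0.trans ht.1.le, ht.2.le.trans hyS.1.2⟩, hft⟩, ht.1⟩) (not_le.2 ht.2))
    exact ⟨c, hgc, hc.1, hc.2.trans_le hyS.1.2, fun z hz hxz => hc.2.trans_le (hymin z ⟨hz, hxz⟩)⟩
  choose! c hgc hxc hca hcz using hnext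
  have hmono : StrictMonoOn c (S \ {a}) := fun x hx z hz hxz =>
    (hcz x hx z hz.1 hxz).trans (hxc z hz)
  have hcard : (c '' (S \ {a})).ncard + 1 = m := by
    rw [hmono.injOn.ncard_image, ncard_sdiff_singleton_add_one haS hS, hm]
  have hfin : (c '' (S \ {a})).Finite := (hS.subset sdiff_subset).image c
  have hna : a ∉ c '' (S \ {a}) := by
    rintro ⟨x, hx, hxa⟩
    exact (hca x hx).ne hxa
  have hn0 : (0 : ℝ) ∉ insert a (c '' (S \ {a})) := by
    rintro (h | ⟨x, hx, hx0⟩)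
    · exact ha.ne h
    · exact (hx.1.1.1.trans_lt (hxc x hx)).ne' hx0
  rw [← hcard, ← ncard_insert_of_notMem hna hfin,
    ← ncard_insert_of_notMem hn0 (hfin.insert a)]
  refine ncard_le_ncard ?_ hT
  rintro z (rfl | rfl | ⟨x, hx, rfl⟩)
  · exact ⟨⟨le_rfl, ha.le⟩, hg0⟩
  · exact ⟨⟨ha.le, le_rfl⟩, hga⟩
  · exact ⟨⟨hx.1.1.1.trans (hxc x hx).le, (hca x hx).le⟩, hgc x hx⟩
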